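/- Let N ≥ 2 be an integer. Define g(α) = J₋(α) · I₋(α)^{(1−N)/N} for α ∈ [0, π), where I₋(α) = ∫_α^π (sin θ)^N dθ and J₋(α) = ∫_α^π (sin θ)^{N−2} dθ. Then there exists δ ∈ (0, π) such that g is strictly decreasing on [0, δ); in particular g(α) < g(0) for all α ∈ (0, δ). -/

import Mathlib

open Real

noncomputable def Im (N : ℕ) (α : ℝ) : ℝ := ∫ θ in α..π, sin θ ^ N

noncomputable def Jm (N : ℕ) (α : ℝ) : ℝ := ∫ θ in α..π, sin θ ^ (N - 2)

noncomputable def g (N : ℕ) (α : ℝ) : ℝ := Jm N α * Im N α ^ ((1 - (N : ℝ)) / N)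

theorem hasDerivAt_integral_sin_pow_left (n : ℕ) (b α : ℝ) :
    HasDerivAt (fun x => ∫ θ in x..b, sin θ ^ n) (-sin α ^ n) α := by
  have hc : Continuous fun θ : ℝ => sin θ ^ n := by fun_prop
  exact intervalIntegral.integral_hasDerivAt_left (hc.intervalIntegrable _ _)
    (hc.stronglyMeasurableAtFilter _ _) hc.continuousAt

theorem hasDerivAt_Im (N : ℕ) (α : ℝ) : HasDerivAt (Im N) (-sin α ^ N) α :=
  hasDerivAt_integral_sin_pow_left N π α

theorem hasDerivAt_Jm (N : ℕ) (α : ℝ) : HasDerivAt (Jm N) (-sin α ^ (N - 2)) α :=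
  hasDerivAt_integral_sin_pow_left (N - 2) π α

theorem continuous_Im (N : ℕ) : Continuous (Im N) :=
  continuous_iff_continuousAt.2 fun α => (hasDerivAt_Im N α).continuousAt

theorem continuous_Jm (N : ℕ) : Continuous (Jm N) :=
  continuous_iff_continuousAt.2 fun α => (hasDerivAt_Jm N α).continuousAt

theorem Im_zero_pos (N : ℕ) : 0 < Im N 0 := integral_sin_pow_pos N

theorem hasDerivAt_g {N : ℕ} (hN : 2 ≤ N) {α : ℝ} (hI : 0 < Im N α) :
    HasDerivAt (g N)
      (-(sin α ^ (N - 2) * Im N α ^ ((1 - (N : ℝ)) / N - 1) *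
        (Im N α + (1 - (N : ℝ)) / N * Jm N α * sin α ^ 2))) α := by
  have h := (hasDerivAt_Jm N α).mul
    ((hasDerivAt_Im N α).rpow_const (p := (1 - (N : ℝ)) / N) (Or.inl hI.ne'))
  refine h.congr_deriv ?_
  have hs : sin α ^ N = sin α ^ (N - 2) * sin α ^ 2 := by
    rw [← pow_add, Nat.sub_add_cancel hN]
  have hp : Im N α ^ ((1 - (N : ℝ)) / N) = Im N α ^ ((1 - (N : ℝ)) / N - 1) * Im N α := by
    rw [← rpow_add_one hI.ne', sub_add_cancel]
  rw [hs, hp]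
  ring

theorem stmt_17 (N : ℕ) (hN : 2 ≤ N) :
    ∃ δ ∈ Set.Ioo (0:ℝ) π,
      StrictAntiOn (g N) (Set.Ico 0 δ) ∧ ∀ α ∈ Set.Ioo (0:ℝ) δ, g N α < g N 0 := by
  have hcI := continuous_Im N
  have hcJ := continuous_Jm N
  have hbracket : ∀ᶠ α in nhds (0 : ℝ),
      0 < Im N α + (1 - (N : ℝ)) / N * Jm N α * sin α ^ 2 := by
    have hc : Continuous fun α =>
        Im N α + (1 - (N : ℝ)) / N * Jm N α * sin α ^ 2 := by fun_prop
    exact hc.continuousAt.eventually_const_lt (by simpa using Im_zero_pos N)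
  have hpos : ∀ᶠ α in nhds (0 : ℝ), 0 < Im N α :=
    hcI.continuousAt.eventually_const_lt (Im_zero_pos N)
  obtain ⟨ε, hε, hball⟩ := Metric.eventually_nhds_iff.1 (hpos.and hbracket)
  have hδ : 0 < min ε 1 := lt_min hε one_pos
  have hδπ : min ε 1 < π := (min_le_right _ _).trans_lt (by linarith [pi_gt_three])
  have hmem : ∀ α ∈ Set.Ico 0 (min ε 1), 0 < Im N α ∧
      0 < Im N α + (1 - (N : ℝ)) / N * Jm N α * sin α ^ 2 := fun α hα => hball <| by
    rw [Real.dist_eq, sub_zero, abs_of_nonneg hα.1]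
    exact hα.2.trans_le (min_le_left _ _)
  have hanti : StrictAntiOn (g N) (Set.Ico 0 (min ε 1)) := by
    refine strictAntiOn_of_deriv_neg (convex_Ico _ _)
      (fun α hα => (hasDerivAt_g hN (hmem α hα).1).continuousAt.continuousWithinAt)
      fun α hα => ?_
    rw [interior_Ico] at hα
    obtain ⟨hI, hB⟩ := hmem α (Set.Ioo_subset_Ico_self hα)
    have hsin : 0 < sin α := sin_pos_of_pos_of_lt_pi hα.1 (hα.2.trans hδπ)
    rw [(hasDerivAt_g hN hI).deriv, neg_lt_zero]
    exact mul_pos (mul_pos (pow_pos hsin _) (rpow_pos_of_pos hI _)) hB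
  exact ⟨min ε 1, ⟨hδ, hδπ⟩, hanti, fun α hα =>
    hanti ⟨le_rfl, hδ⟩ (Set.Ioo_subset_Ico_self hα) hα.1⟩
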